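/- Let 𝒳 be a measurable space, let n ≥ 1 and α ∈ (0,1) with α(n+1) ≥ 1, and let (X_1,Y_1),…,(X_{n+1},Y_{n+1}) be exchangeable random variables with values in 𝒳 × ℝ. Let μ be a symmetric regression algorithm, let ĝ_{-i} = μ({(X_1,Y_1),…,(X_n,Y_n)} ∖ {(X_i,Y_i)}) be the leave-one-out predictors, and let R_i^{LOO} = |Y_i − ĝ_{-i}(X_i)| be the leave-one-out residuals, for i = 1,…,n. Define the Jackknife-minmax prediction interval Ĉ(X_{n+1}) = [ min_{i=1,…,n} ĝ_{-i}(X_{n+1}) − q̂⁺_{n,α}{ R_i^{LOO} } , max_{i=1,…,n} ĝ_{-i}(X_{n+1}) + q̂⁺_{n,α}{ R_i^{LOO} } ]. Then ℙ( Y_{n+1} ∈ Ĉ(X_{n+1}) ) ≥ 1 − α. -/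

import Mathlib

open MeasureTheory

/-- The `k`-th smallest value (1-indexed) among `v 0, …, v (n-1)`. -/
noncomputable def orderStat {n : ℕ} (v : Fin n → ℝ) (k : ℕ) : ℝ :=
  if h : k - 1 < n then v (Tuple.sort v ⟨k - 1, h⟩) else 0

/-- The `(1-α)`-empirical quantile: the `⌈(1-α)(n+1)⌉`-th smallest value of `v`. -/
noncomputable def qPlus {n : ℕ} (α : ℝ) (v : Fin n → ℝ) : ℝ :=
  orderStat v ⌈(1 - α) * (n + 1)⌉₊

/-- The `α`-empirical quantile: the `⌊α(n+1)⌋`-th smallest value of `v`. -/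
noncomputable def qMinus {n : ℕ} (α : ℝ) (v : Fin n → ℝ) : ℝ :=
  orderStat v ⌊α * (n + 1)⌋₊

/-- A finite family of random variables is exchangeable if its joint law is invariant
under permutations of the indices. -/
def Exchangeable {Ω E : Type*} [MeasurableSpace Ω] [MeasurableSpace E]
    (P : Measure Ω) {m : ℕ} (Z : Fin m → Ω → E) : Prop :=
  ∀ π : Equiv.Perm (Fin m),
    Measure.map (fun ω i => Z (π i) ω) P = Measure.map (fun ω i => Z i ω) P

/-- A regression/dispersion algorithm (assigning to each finite sample of points of
`𝒳 × ℝ` a function `𝒳 → ℝ`) is symmetric if it depends on the training sample only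
through its multiset of values. -/
def IsSymmetricAlg {𝒳 : Type*} (μ : (m : ℕ) → (Fin m → 𝒳 × ℝ) → 𝒳 → ℝ) : Prop :=
  ∀ (m : ℕ) (π : Equiv.Perm (Fin m)) (d : Fin m → 𝒳 × ℝ), μ m (d ∘ ⇑π) = μ m d

open Finset in
/-- The injection `Fin k → Fin (k + 2)` enumerating the indices other than `i` and `j`
(constant if `i = j`). -/
noncomputable def avoidPair {k : ℕ} (i j : Fin (k + 2)) (p : Fin k) : Fin (k + 2) :=
  if h : i ≠ j then
    ({i, j}ᶜ : Finset (Fin (k + 2))).orderEmbOfFin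
      (by rw [card_compl, card_pair h, Fintype.card_fin, Nat.add_sub_cancel]) p
  else 0

lemma avoidPair_injective {k : ℕ} {i j : Fin (k + 2)} (h : i ≠ j) :
    Function.Injective (avoidPair i j) := by
  intro a b hab
  simpa [avoidPair, h] using hab

lemma range_avoidPair {k : ℕ} {i j : Fin (k + 2)} (h : i ≠ j) :
    Set.range (avoidPair i j) = {i, j}ᶜ := by
  have hfun : avoidPair i j = ({i, j}ᶜ : Finset (Fin (k + 2))).orderEmbOfFin
      (by rw [Finset.card_compl, Finset.card_pair h, Fintype.card_fin, Nat.add_sub_cancel]) := by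
    ext p
    simp [avoidPair, h]
  rw [hfun, Finset.range_orderEmbOfFin, Finset.coe_compl, Finset.coe_pair]

/-- A symmetric algorithm gives the same predictor on two enumerations of the same
subsample. -/
lemma IsSymmetricAlg.comp_eq_of_range_eq {𝒳 ι : Type*}
    {μ : (m : ℕ) → (Fin m → 𝒳 × ℝ) → 𝒳 → ℝ} (hμ : IsSymmetricAlg μ) {m : ℕ}
    (z : ι → 𝒳 × ℝ) {e e' : Fin m → ι} (he : Function.Injective e)
    (he' : Function.Injective e') (hr : Set.range e = Set.range e') :
    μ m (z ∘ e) = μ m (z ∘ e') := by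
  let π : Equiv.Perm (Fin m) := (Equiv.ofInjective e he).trans
    ((Equiv.setCongr hr).trans (Equiv.ofInjective e' he').symm)
  have hπ : e = e' ∘ π := by
    ext p
    simp only [π, Function.comp_apply, Equiv.trans_apply, Equiv.apply_ofInjective_symm]
    rfl
  rw [hπ, ← Function.comp_assoc]
  exact hμ m π (z ∘ e')

/-- The residual at the `i`-th point of the predictor trained without the `i`-th and
`j`-th points. -/
noncomputable def pairResidual {𝒳 : Type*} (μ : (m : ℕ) → (Fin m → 𝒳 × ℝ) → 𝒳 → ℝ) {k : ℕ}
    (z : Fin (k + 2) → 𝒳 × ℝ) (i j : Fin (k + 2)) : ℝ :=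
  |(z i).2 - μ k (z ∘ avoidPair i j) (z i).1|

lemma pairResidual_eq {𝒳 : Type*} {μ : (m : ℕ) → (Fin m → 𝒳 × ℝ) → 𝒳 → ℝ}
    (hμ : IsSymmetricAlg μ) {k : ℕ} (z : Fin (k + 2) → 𝒳 × ℝ) {i j : Fin (k + 2)} (h : i ≠ j)
    {e : Fin k → Fin (k + 2)} (he : Function.Injective e) (hr : Set.range e = {i, j}ᶜ) :
    pairResidual μ z i j = |(z i).2 - μ k (z ∘ e) (z i).1| := by
  rw [pairResidual, hμ.comp_eq_of_range_eq z (avoidPair_injective h) he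
    ((range_avoidPair h).trans hr.symm)]

lemma pairResidual_comp_perm {𝒳 : Type*} {μ : (m : ℕ) → (Fin m → 𝒳 × ℝ) → 𝒳 → ℝ}
    (hμ : IsSymmetricAlg μ) {k : ℕ} (z : Fin (k + 2) → 𝒳 × ℝ) (π : Equiv.Perm (Fin (k + 2)))
    {i j : Fin (k + 2)} (h : i ≠ j) :
    pairResidual μ (z ∘ π) i j = pairResidual μ z (π i) (π j) := by
  rw [pairResidual_eq hμ z (π.injective.ne h) (π.injective.comp (avoidPair_injective h))]
  · rfl
  · rw [Set.range_comp, range_avoidPair h, Set.image_compl_eq π.bijective, Set.image_pair]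

lemma measurable_pairResidual {𝒳 : Type*} [MeasurableSpace 𝒳]
    {μ : (m : ℕ) → (Fin m → 𝒳 × ℝ) → 𝒳 → ℝ}
    (hμ : ∀ m, Measurable fun p : (Fin m → 𝒳 × ℝ) × 𝒳 => μ m p.1 p.2) {k : ℕ}
    (i j : Fin (k + 2)) :
    Measurable fun z : Fin (k + 2) → 𝒳 × ℝ => pairResidual μ z i j := by
  have hpair : Measurable fun z : Fin (k + 2) → 𝒳 × ℝ => (z ∘ avoidPair i j, (z i).1) :=
    (measurable_pi_lambda _ fun p => measurable_pi_apply _).prodMk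
      (measurable_pi_apply i).fst
  exact measurable_norm.comp ((measurable_pi_apply i).snd.sub ((hμ k).comp hpair))

/-- The index `i` is strange at level `K` if at least `K` other indices `j` have a residual
`r j i` below all the residuals `r i l`, `l ≠ i`. -/
def IsStrange {N : ℕ} (r : Fin N → Fin N → ℝ) (K : ℕ) (i : Fin N) : Prop :=
  ∃ s : Finset (Fin N), K ≤ s.card ∧ ∀ j ∈ s, j ≠ i ∧ ∀ l, l ≠ i → r j i < r i l

/-- At most `N - K` indices are strange at level `K`. -/
lemma card_add_le_of_isStrange {N : ℕ} (r : Fin N → Fin N → ℝ) (K : ℕ) (S : Finset (Fin N))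
    (hS : ∀ i ∈ S, IsStrange r K i) (hK : K ≤ N) : S.card + K ≤ N := by
  rcases S.eq_empty_or_nonempty with rfl | hne
  · simpa using hK
  obtain ⟨i, hi, hmin⟩ := S.exists_min_image (fun i => ⨅ l : {l // l ≠ i}, r i l) hne
  obtain ⟨s, hs, hsr⟩ := hS i hi
  have hdisj : Disjoint S s := by
    rw [Finset.disjoint_left]
    intro j hjS hjs
    obtain ⟨hji, hlt⟩ := hsr j hjs
    have : Nonempty {l // l ≠ i} := ⟨⟨j, hji⟩⟩
    obtain ⟨l, hl⟩ := exists_eq_ciInf_of_finite (f := fun l : {l // l ≠ i} => r i l)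
    have hle : (⨅ l : {l // l ≠ j}, r j l) ≤ r j i :=
      ciInf_le (Set.finite_range fun l : {l // l ≠ j} => r j l).bddBelow ⟨i, hji.symm⟩
    have hmin' := hmin j hjS
    have hlt' := hlt l l.2
    linarith
  calc S.card + K ≤ S.card + s.card := by gcongr
    _ = (S ∪ s).card := (Finset.card_union_of_disjoint hdisj).symm
    _ ≤ N := by simpa using Finset.card_le_univ (S ∪ s)

lemma IsStrange.of_comp_perm {𝒳 : Type*} {μ : (m : ℕ) → (Fin m → 𝒳 × ℝ) → 𝒳 → ℝ}
    (hμ : IsSymmetricAlg μ) {k K : ℕ} {z : Fin (k + 2) → 𝒳 × ℝ}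
    (π : Equiv.Perm (Fin (k + 2))) {i : Fin (k + 2)}
    (h : IsStrange (pairResidual μ (z ∘ π)) K i) : IsStrange (pairResidual μ z) K (π i) := by
  obtain ⟨s, hs, hsr⟩ := h
  refine ⟨s.map π.toEmbedding, by simpa using hs, ?_⟩
  intro j hj
  obtain ⟨j, hjs, rfl⟩ := Finset.mem_map.1 hj
  obtain ⟨hji, hlt⟩ := hsr j hjs
  refine ⟨π.injective.ne hji, fun l hl => ?_⟩
  have hl' : π.symm l ≠ i := fun h => hl (by rw [← h, π.apply_symm_apply])
  have := hlt _ hl'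
  rwa [pairResidual_comp_perm hμ z π hji, pairResidual_comp_perm hμ z π hl'.symm,
    π.apply_symm_apply] at this

lemma isStrange_comp_perm_iff {𝒳 : Type*} {μ : (m : ℕ) → (Fin m → 𝒳 × ℝ) → 𝒳 → ℝ}
    (hμ : IsSymmetricAlg μ) {k K : ℕ} {z : Fin (k + 2) → 𝒳 × ℝ}
    (π : Equiv.Perm (Fin (k + 2))) {i : Fin (k + 2)} :
    IsStrange (pairResidual μ (z ∘ π)) K i ↔ IsStrange (pairResidual μ z) K (π i) := by
  refine ⟨IsStrange.of_comp_perm hμ π, fun h => ?_⟩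
  have hz : (z ∘ π) ∘ π.symm = z := by
    ext1 a
    simp
  rw [← π.symm_apply_apply i]
  exact IsStrange.of_comp_perm (z := z ∘ π) hμ π.symm (hz.symm ▸ h)

lemma measurableSet_isStrange {𝒳 : Type*} [MeasurableSpace 𝒳]
    {μ : (m : ℕ) → (Fin m → 𝒳 × ℝ) → 𝒳 → ℝ}
    (hμ : ∀ m, Measurable fun p : (Fin m → 𝒳 × ℝ) × 𝒳 => μ m p.1 p.2) {k : ℕ} (K : ℕ)
    (i : Fin (k + 2)) :
    MeasurableSet {z : Fin (k + 2) → 𝒳 × ℝ | IsStrange (pairResidual μ z) K i} := by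
  have hlt : ∀ j l, MeasurableSet
      {z : Fin (k + 2) → 𝒳 × ℝ | pairResidual μ z j i < pairResidual μ z i l} := fun j l =>
    measurableSet_lt (measurable_pairResidual hμ j i) (measurable_pairResidual hμ i l)
  simp only [measurableSet_setOfPred] at hlt
  rw [measurableSet_setOfPred]
  unfold IsStrange
  exact Measurable.exists fun s => measurable_const.and <| Measurable.forall fun j =>
    measurable_const.imp <| measurable_const.and <| Measurable.forall fun l =>
    measurable_const.imp (hlt j l)

open scoped ENNReal in
/-- If at every point at most `c` of the finitely many events `A i` occur, then their
probabilities sum to at most `c`. -/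
lemma sum_measure_le_of_card_le {Ω ι : Type*} [MeasurableSpace Ω] [Fintype ι] (P : Measure Ω)
    [IsProbabilityMeasure P] (A : ι → Set Ω) (hA : ∀ i, MeasurableSet (A i)) (c : ℕ)
    (hc : ∀ ω, ∀ S : Finset ι, (∀ i ∈ S, ω ∈ A i) → S.card ≤ c) :
    ∑ i, P (A i) ≤ c := by
  classical
  calc ∑ i, P (A i) = ∫⁻ ω, ∑ i, (A i).indicator 1 ω ∂P := by
        rw [lintegral_finsetSum _ fun i _ => measurable_one.indicator (hA i)]
        simp [hA]
    _ ≤ ∫⁻ _, (c : ℝ≥0∞) ∂P := by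
        refine lintegral_mono fun ω => ?_
        have hcard := hc ω {i | ω ∈ A i} (by simp)
        simp only [Set.indicator_apply, Pi.one_apply, Finset.sum_boole]
        exact_mod_cast hcard
    _ = c := by simp

/-- Under exchangeability, the last index is strange at level `K` with probability at most
`(N - K) / N`. -/
lemma measure_isStrange_last_le {Ω 𝒳 : Type*} [MeasurableSpace Ω] [MeasurableSpace 𝒳]
    (P : Measure Ω) [IsProbabilityMeasure P] {k K : ℕ} (hK : K ≤ k + 2)
    (Z : Fin (k + 2) → Ω → 𝒳 × ℝ) (hZ : ∀ i, Measurable (Z i)) (hexch : Exchangeable P Z)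
    {μ : (m : ℕ) → (Fin m → 𝒳 × ℝ) → 𝒳 → ℝ} (hμsymm : IsSymmetricAlg μ)
    (hμmeas : ∀ m, Measurable fun p : (Fin m → 𝒳 × ℝ) × 𝒳 => μ m p.1 p.2) :
    ((k : ℝ) + 2) * P.real {ω | IsStrange (pairResidual μ fun i => Z i ω) K (Fin.last (k + 1))}
      ≤ k + 2 - K := by
  let A : Fin (k + 2) → Set Ω := fun i => {ω | IsStrange (pairResidual μ fun i => Z i ω) K i}
  have hmeas : ∀ π : Equiv.Perm (Fin (k + 2)), Measurable fun ω i => Z (π i) ω :=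
    fun π => measurable_pi_lambda _ fun i => hZ _
  have hW := measurableSet_isStrange hμmeas K (Fin.last (k + 1))
  have hA : ∀ i, P (A i) = P (A (Fin.last (k + 1))) := by
    intro i
    let π : Equiv.Perm (Fin (k + 2)) := Equiv.swap i (Fin.last (k + 1))
    have h := congrArg (fun ν => ν {z | IsStrange (pairResidual μ z) K (Fin.last (k + 1))})
      (hexch π)
    beta_reduce at h
    rw [Measure.map_apply (hmeas π) hW, Measure.map_apply (measurable_pi_lambda _ hZ) hW] at h
    rw [← show _ = P (A (Fin.last (k + 1))) from h]
    congr 1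
    ext ω
    have := isStrange_comp_perm_iff hμsymm (K := K) (z := fun i => Z i ω) π
      (i := Fin.last (k + 1))
    rw [show π (Fin.last (k + 1)) = i from Equiv.swap_apply_right _ _] at this
    exact this.symm
  have hsum := sum_measure_le_of_card_le P A
    (fun i => measurable_pi_lambda _ hZ (measurableSet_isStrange hμmeas K i)) (k + 2 - K)
    (fun ω S hS => Nat.le_sub_of_add_le (card_add_le_of_isStrange _ K S hS hK))
  simp only [hA, Finset.sum_const, Finset.card_univ, Fintype.card_fin, nsmul_eq_mul] at hsum
  have hreal := ENNReal.toReal_mono (ENNReal.natCast_ne_top _) hsum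
  rw [ENNReal.toReal_mul, ENNReal.toReal_natCast, ENNReal.toReal_natCast, Nat.cast_sub hK]
    at hreal
  push_cast at hreal
  exact hreal

/-- At least `K` entries of `v` are at most its `K`-th smallest value. -/
lemma exists_card_eq_forall_le_orderStat {n : ℕ} (v : Fin n → ℝ) {K : ℕ} (hK : 1 ≤ K)
    (hKn : K ≤ n) : ∃ s : Finset (Fin n), s.card = K ∧ ∀ i ∈ s, v i ≤ orderStat v K := by
  have h : K - 1 < n := by omega
  refine ⟨(Finset.Iic ⟨K - 1, h⟩).map (Tuple.sort v).toEmbedding, ?_, ?_⟩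
  · rw [Finset.card_map, Fin.card_Iic]
    exact Nat.sub_add_cancel hK
  · intro i hi
    obtain ⟨a, ha, rfl⟩ := Finset.mem_map.1 hi
    rw [orderStat, dif_pos h]
    exact Tuple.monotone_sort v (Finset.mem_Iic.1 ha)

lemma range_castSucc_comp_succAbove {k : ℕ} (j : Fin (k + 1)) :
    Set.range (Fin.castSucc ∘ j.succAbove) = {j.castSucc, Fin.last (k + 1)}ᶜ := by
  rw [Set.range_comp, Fin.range_succAbove]
  ext a
  refine Fin.lastCases ?_ (fun b => ?_) a <;> simp

/-- If the minmax interval with margin `orderStat _ K` misses the last response, then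
the last index is strange at level `K`. -/
lemma isStrange_last_of_not_covered {𝒳 : Type*} {μ : (m : ℕ) → (Fin m → 𝒳 × ℝ) → 𝒳 → ℝ}
    (hμ : IsSymmetricAlg μ) {k K : ℕ} (hK : 1 ≤ K) (hKk : K ≤ k + 1)
    (z : Fin (k + 2) → 𝒳 × ℝ) (g : Fin (k + 1) → 𝒳 → ℝ) (R : Fin (k + 1) → ℝ)
    (hg : ∀ i, g i = μ k (i.removeNth fun j => z j.castSucc))
    (hR : ∀ i, R i = |(z i.castSucc).2 - g i (z i.castSucc).1|)
    (h : ¬ ((⨅ i, g i (z (Fin.last (k + 1))).1) - orderStat R K ≤ (z (Fin.last (k + 1))).2 ∧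
      (z (Fin.last (k + 1))).2 ≤ (⨆ i, g i (z (Fin.last (k + 1))).1) + orderStat R K)) :
    IsStrange (pairResidual μ z) K (Fin.last (k + 1)) := by
  have hinj : ∀ j : Fin (k + 1), Function.Injective (Fin.castSucc ∘ j.succAbove) := fun j =>
    (Fin.castSucc_injective _).comp Fin.succAbove_right_injective
  have htrain : ∀ j, pairResidual μ z j.castSucc (Fin.last (k + 1)) = R j := fun j => by
    rw [pairResidual_eq hμ z (Fin.castSucc_ne_last j) (hinj j) (range_castSucc_comp_succAbove j),
      hR, hg]
    rfl
  have htest : ∀ j, pairResidual μ z (Fin.last (k + 1)) j.castSucc =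
      |(z (Fin.last (k + 1))).2 - g j (z (Fin.last (k + 1))).1| := fun j => by
    rw [pairResidual_eq hμ z (Fin.castSucc_ne_last j).symm (hinj j)
      ((range_castSucc_comp_succAbove j).trans (by rw [Set.pair_comm])), hg]
    rfl
  have hlt : ∀ j, orderStat R K < |(z (Fin.last (k + 1))).2 - g j (z (Fin.last (k + 1))).1| := by
    intro j
    have hfin := Set.finite_range fun i => g i (z (Fin.last (k + 1))).1
    have hinf := ciInf_le hfin.bddBelow j
    have hsup := le_ciSup hfin.bddAbove j
    rw [lt_abs]
    by_cases hy : (⨅ i, g i (z (Fin.last (k + 1))).1) - orderStat R K ≤ (z (Fin.last (k + 1))).2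
    · have := not_le.1 fun hle => h ⟨hy, hle⟩
      left
      linarith
    · right
      linarith
  obtain ⟨s, hs, hsR⟩ := exists_card_eq_forall_le_orderStat R hK hKk
  refine ⟨s.map Fin.castSuccEmb, by simp [hs], fun j hj => ?_⟩
  obtain ⟨j, hjs, rfl⟩ := Finset.mem_map.1 hj
  refine ⟨Fin.castSucc_ne_last j, fun l hl => ?_⟩
  obtain ⟨l, rfl⟩ := Fin.exists_castSucc_eq.2 hl
  rw [Fin.coe_castSuccEmb, htrain, htest]
  exact (hsR j hjs).trans_lt (hlt l)

/-- **Jackknife-minmax coverage.** For exchangeable data (`k+1` training points plus one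
test point) and a symmetric regression algorithm `μ`, the Jackknife-minmax interval
`[ min_i ĝ_{-i}(X_{n+1}) - q̂⁺{R_i}, max_i ĝ_{-i}(X_{n+1}) + q̂⁺{R_i} ]` built from the
leave-one-out residuals `R_i = |Y_i - ĝ_{-i}(X_i)|` has marginal coverage at least
`1 - α`. -/
theorem jackknifeMinmax_coverage
    {Ω 𝒳 : Type*} [MeasurableSpace Ω] [MeasurableSpace 𝒳]
    (P : Measure Ω) [IsProbabilityMeasure P]
    (k : ℕ) (α : ℝ) (hα : α ∈ Set.Ioo (0 : ℝ) 1)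
    (hαn : (1 : ℝ) ≤ α * (k + 2))
    (Z : Fin (k + 2) → Ω → 𝒳 × ℝ) (hZ : ∀ i, Measurable (Z i))
    (hexch : Exchangeable P Z)
    (μ : (m : ℕ) → (Fin m → 𝒳 × ℝ) → 𝒳 → ℝ)
    (hμsymm : IsSymmetricAlg μ)
    (hμmeas : ∀ m, Measurable fun p : (Fin m → 𝒳 × ℝ) × 𝒳 => μ m p.1 p.2) :
    (1 : ℝ) - α ≤
      (P {ω |
        let D : Fin (k + 1) → 𝒳 × ℝ := fun j => Z j.castSucc ω
        let g : Fin (k + 1) → 𝒳 → ℝ := fun i => μ k (i.removeNth D)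
        let R : Fin (k + 1) → ℝ := fun i => |(D i).2 - g i (D i).1|
        let x : 𝒳 := (Z (Fin.last (k + 1)) ω).1
        let y : ℝ := (Z (Fin.last (k + 1)) ω).2
        (⨅ i, g i x) - qPlus α R ≤ y ∧ y ≤ (⨆ i, g i x) + qPlus α R}).toReal := by
  have hceil : (1 - α) * ((k + 1 : ℕ) + 1 : ℝ) ≤ ⌈(1 - α) * ((k + 1 : ℕ) + 1 : ℝ)⌉₊ :=
    Nat.le_ceil _
  have hK : 1 ≤ ⌈(1 - α) * ((k + 1 : ℕ) + 1 : ℝ)⌉₊ :=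
    Nat.one_le_ceil_iff.2 (mul_pos (by linarith [hα.2]) (by positivity))
  have hKk : ⌈(1 - α) * ((k + 1 : ℕ) + 1 : ℝ)⌉₊ ≤ k + 1 := by
    rw [Nat.ceil_le]
    push_cast
    linarith
  set K := ⌈(1 - α) * ((k + 1 : ℕ) + 1 : ℝ)⌉₊
  have hbad := measure_isStrange_last_le P (hKk.trans (Nat.le_succ _)) Z hZ hexch hμsymm hμmeas
  set B := {ω | IsStrange (pairResidual μ fun i => Z i ω) K (Fin.last (k + 1))}
  have hBα : P.real B ≤ α := by
    push_cast at hceil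
    have : ((k : ℝ) + 2) * P.real B ≤ (k + 2) * α := by linarith
    exact le_of_mul_le_mul_left this (by positivity)
  rw [← measureReal_def]
  refine le_trans ?_ (sub_le_iff_le_add.2 ((probReal_univ (μ := P)).symm.trans_le
    ((measureReal_mono fun ω _ => ?_).trans (measureReal_union_le _ B))))
  · linarith
  · by_cases hB' : ω ∈ B
    · exact Or.inr hB'
    · left
      by_contra hcov
      exact hB' (isStrange_last_of_not_covered hμsymm hK hKk (fun i => Z i ω) _ _
        (fun _ => rfl) (fun _ => rfl) hcov)
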